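/- arXiv:2008.10475 — 2 statements merged into one kernel-verified Lean document; each statement's English description precedes it below -/
import Mathlib

section
/- Let L be a mixed 1-stack 1-queue layout of G(k,ℓ) with k > 4 and ℓ > 6. Then every queue-edge of the subgraph G(k-3,ℓ) has at most six queue-attachments among the ℓ vertices of Ḡ(k-2,ℓ) attached to it in L. -/
/-- Vertices for the graphs `G(k,ℓ)`: two base vertices and, for each step `k`,
each oriented edge `(u,v)` and each index `i : Fin ℓ`, a potential attached vertex. -/
inductive PV (ℓ : ℕ) : Type where
  | A : PV ℓ
  | B : PV ℓ
  | att : ℕ → PV ℓ → PV ℓ → Fin ℓ → PV ℓ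

/-- The (canonically oriented) edges of `G(k,ℓ)`: `G(1,ℓ)` is the single edge `(A,B)`,
and for `k > 1`, `G(k,ℓ)` is obtained from `G(k-1,ℓ)` by attaching `ℓ` new vertices
to each of its edges. -/
def Gedges (ℓ : ℕ) : ℕ → Set (PV ℓ × PV ℓ)
  | 0 => ∅
  | 1 => {p | p = (PV.A, PV.B)}
  | (k + 2) => Gedges ℓ (k + 1) ∪
      {p | ∃ u v, ∃ i : Fin ℓ, (u, v) ∈ Gedges ℓ (k + 1) ∧
        (p = (PV.att (k + 2) u v i, u) ∨ p = (PV.att (k + 2) u v i, v))}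

/-- The graph `G(k,ℓ)`. -/
def Gkl (k ℓ : ℕ) : SimpleGraph (PV ℓ) :=
  SimpleGraph.fromEdgeSet ((fun p => s(p.1, p.2)) '' Gedges ℓ k)

/-- The graph `Ḡ(k,ℓ)` induced by the edges of `G(k,ℓ)` that are not in `G(k-1,ℓ)`. -/
def Gbar (k ℓ : ℕ) : SimpleGraph (PV ℓ) :=
  SimpleGraph.fromEdgeSet ((fun p => s(p.1, p.2)) '' (Gedges ℓ k \ Gedges ℓ (k - 1)))

/-- A mixed 1-stack 1-queue layout of a graph `G`: a strict total (linear) order `lt`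
on the vertices together with an assignment of each edge to the stack (`isStack e`)
or to the queue (`¬ isStack e`), such that no two stack-edges cross and no two
queue-edges nest. -/
structure MixedLayout {V : Type} (G : SimpleGraph V) where
  lt : V → V → Prop
  isSTO : IsStrictTotalOrder V lt
  isStack : Sym2 V → Prop
  noCross : ∀ a b c d : V, G.Adj a b → G.Adj c d →
    isStack s(a, b) → isStack s(c, d) → ¬(lt a c ∧ lt c b ∧ lt b d)
  noNest : ∀ a b c d : V, G.Adj a b → G.Adj c d →
    ¬isStack s(a, b) → ¬isStack s(c, d) → ¬(lt a c ∧ lt c d ∧ lt d b)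

/-- `{a,b}` is an edge of the subgraph `H` that is a stack-edge in the layout `L`. -/
def SEdgeIn {V : Type} {G : SimpleGraph V} (L : MixedLayout G) (H : SimpleGraph V)
    (a b : V) : Prop :=
  H.Adj a b ∧ L.isStack s(a, b)

/-- `{a,b}` is an edge of the subgraph `H` that is a queue-edge in the layout `L`. -/
def QEdgeIn {V : Type} {G : SimpleGraph V} (L : MixedLayout G) (H : SimpleGraph V)
    (a b : V) : Prop :=
  H.Adj a b ∧ ¬L.isStack s(a, b)

/-- `x` is a stack-attachment of the edge `{u,v}`: both `{x,u}` and `{x,v}` are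
stack-edges. -/
def StackAtt {V : Type} {G : SimpleGraph V} (L : MixedLayout G) (x u v : V) : Prop :=
  SEdgeIn L G x u ∧ SEdgeIn L G x v

/-- `x` is a queue-attachment of the edge `{u,v}`: both `{x,u}` and `{x,v}` are
queue-edges. -/
def QueueAtt {V : Type} {G : SimpleGraph V} (L : MixedLayout G) (x u v : V) : Prop :=
  QEdgeIn L G x u ∧ QEdgeIn L G x v

/-- `x` is a mixed-attachment of the edge `{u,v}`: one of `{x,u}`, `{x,v}` is a
stack-edge and the other is a queue-edge. -/
def MixedAtt {V : Type} {G : SimpleGraph V} (L : MixedLayout G) (x u v : V) : Prop :=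
  (SEdgeIn L G x u ∧ QEdgeIn L G x v) ∨ (QEdgeIn L G x u ∧ SEdgeIn L G x v)

/-- `x` is one of the vertices of `Ḡ(k,ℓ)` attached to the edge `{u,v}`, i.e. both
`{x,u}` and `{x,v}` are edges of `Ḡ(k,ℓ)`. -/
def AttachedAt (ℓ k : ℕ) (x u v : PV ℓ) : Prop :=
  (Gbar k ℓ).Adj x u ∧ (Gbar k ℓ).Adj x v

/-- A smiley face `⟨a,b,u,v,c,d⟩` formed by vertices and edges of the subgraph `H`
in the layout `L`: `a ≺ b ≺ u ≺ v ≺ c ≺ d`, the edges `{a,b}`, `{c,d}`, `{a,d}` of `H`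
are queue-edges and the edge `{u,v}` of `H` is a stack-edge. -/
def Smiley {V : Type} {G : SimpleGraph V} (L : MixedLayout G) (H : SimpleGraph V)
    (a b u v c d : V) : Prop :=
  L.lt a b ∧ L.lt b u ∧ L.lt u v ∧ L.lt v c ∧ L.lt c d ∧
  QEdgeIn L H a b ∧ QEdgeIn L H c d ∧ QEdgeIn L H a d ∧ SEdgeIn L H u v

/-- A linearly ordered graph whose edges are split into a stack `S` and a queue `Q`, together
with two subgraphs `E₁ ≤ E₂` on vertex sets `W₁ ⊆ W₂` such that every edge of `E₁` has seven
fresh attachments in `E₂` and every edge of `E₂` has seven fresh attachments in `S ∪ Q`. -/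
structure LayeredLayout (V : Type) [LinearOrder V] where
  S : V → V → Prop
  Q : V → V → Prop
  E₁ : V → V → Prop
  E₂ : V → V → Prop
  W₁ : V → Prop
  W₂ : V → Prop
  S_symm : ∀ {a b}, S a b → S b a
  Q_symm : ∀ {a b}, Q a b → Q b a
  E₁_symm : ∀ {a b}, E₁ a b → E₁ b a
  E₂_symm : ∀ {a b}, E₂ a b → E₂ b a
  noCross : ∀ {a b c d}, S a b → S c d → a < c → c < b → b < d → False
  noNest : ∀ {a b c d}, Q a b → Q c d → a < c → c < d → d < b → False
  mem_W₁ : ∀ {a b}, E₁ a b → W₁ a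
  mem_W₂ : ∀ {a b}, E₂ a b → W₂ a
  W₁_sub : ∀ {a}, W₁ a → W₂ a
  E₂_edge : ∀ {a b}, E₂ a b → S a b ∨ Q a b
  attach₁ : ∀ {p q}, E₁ p q → ∃ T : Finset V, T.card = 7 ∧
    ∀ y ∈ T, ¬ W₁ y ∧ E₂ y p ∧ E₂ y q
  attach₂ : ∀ {p q}, E₂ p q → ∃ T : Finset V, T.card = 7 ∧
    ∀ z ∈ T, ¬ W₂ z ∧ (S z p ∨ Q z p) ∧ (S z q ∨ Q z q)

/-- A finset covered by `n` classes, each with at most one element, has at most `n` elements. -/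
theorem Finset.card_le_of_subsingleton_classes {V : Type} [LinearOrder V] (T : Finset V) (n : ℕ)
    (P : Fin n → V → Prop) (hcover : ∀ z ∈ T, ∃ i, P i z)
    (hP : ∀ i, ∀ z ∈ T, ∀ z' ∈ T, P i z → P i z' → z < z' → False) : T.card ≤ n := by
  classical
  rcases Nat.eq_zero_or_pos n with rfl | hn
  · rw [Finset.eq_empty_of_forall_notMem (s := T) fun z hz => (hcover z hz).elim fun i _ => i.elim0]
    simp
  · have : Nonempty (Fin n) := ⟨⟨0, hn⟩⟩
    choose! f hf using hcover
    have := Finset.card_le_card_of_injOn (s := T) (t := Finset.univ) f (by simp) (by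
      intro z hz z' hz' h
      rcases lt_trichotomy z z' with hlt | heq | hlt
      · exact (hP _ z hz z' hz' (hf z hz) (h ▸ hf z' hz') hlt).elim
      · exact heq
      · exact (hP _ z' hz' z hz (hf z' hz') (h ▸ hf z hz) hlt).elim)
    simpa using this

namespace LayeredLayout

variable {V : Type} [LinearOrder V]

/-- The layout obtained by reversing the vertex order. -/
def mirror (L : LayeredLayout V) : LayeredLayout Vᵒᵈ where
  S a b := L.S a.ofDual b.ofDual
  Q a b := L.Q a.ofDual b.ofDual
  E₁ a b := L.E₁ a.ofDual b.ofDual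
  E₂ a b := L.E₂ a.ofDual b.ofDual
  W₁ a := L.W₁ a.ofDual
  W₂ a := L.W₂ a.ofDual
  S_symm := L.S_symm
  Q_symm := L.Q_symm
  E₁_symm := L.E₁_symm
  E₂_symm := L.E₂_symm
  noCross h₁ h₂ h₃ h₄ h₅ := L.noCross (L.S_symm h₂) (L.S_symm h₁) h₅ h₄ h₃
  noNest h₁ h₂ h₃ h₄ h₅ := L.noNest (L.Q_symm h₁) (L.Q_symm h₂) h₅ h₄ h₃
  mem_W₁ := L.mem_W₁
  mem_W₂ := L.mem_W₂
  W₁_sub := L.W₁_sub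
  E₂_edge := L.E₂_edge
  attach₁ h := L.attach₁ h
  attach₂ h := L.attach₂ h

/-- An edge nested below a queue-edge is a stack-edge. -/
theorem stack_of_below (L : LayeredLayout V) {a b c d : V} (h : L.Q a b)
    (e : L.S c d ∨ L.Q c d) (hac : a < c) (hcd : c < d) (hdb : d < b) : L.S c d :=
  e.resolve_right fun hq => L.noNest h hq hac hcd hdb

/-- An edge nested above a queue-edge is a stack-edge. -/
theorem stack_of_above (L : LayeredLayout V) {a b c d : V} (h : L.Q c d)
    (e : L.S a b ∨ L.Q a b) (hac : a < c) (hcd : c < d) (hdb : d < b) : L.S a b :=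
  e.resolve_right fun hq => L.noNest hq h hac hcd hdb

/-- An edge with both ends inside a queue-edge is a stack-edge. -/
theorem stack_of_inside (L : LayeredLayout V) {u v c d : V} (h : L.Q u v)
    (e : L.S c d ∨ L.Q c d) (hne : c ≠ d) (hc : u < c) (hc' : c < v) (hd : u < d)
    (hd' : d < v) : L.S c d := by
  rcases hne.lt_or_gt with hlt | hlt
  · exact L.stack_of_below h e hc hlt hd'
  · exact L.S_symm (L.stack_of_below h (e.imp L.S_symm L.Q_symm) hd hlt hc')

/-- Not all attachments of an edge `{p, q}` are stack-attachments or queue-attachments to the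
left of it. -/
theorem false_of_uniform_attachments (L : LayeredLayout V) {p q : V} (hE : L.E₂ p q) (hpq : p < q)
    (h : ∀ z, ¬ L.W₂ z → L.S z p ∨ L.Q z p → L.S z q ∨ L.Q z q →
      (L.S z p ∧ L.S z q) ∨ (L.Q z p ∧ L.Q z q ∧ z < p)) : False := by
  obtain ⟨T, hT, hz⟩ := L.attach₂ hE
  have hp := L.mem_W₂ hE
  have hq := L.mem_W₂ (L.E₂_symm hE)
  have := T.card_le_of_subsingleton_classes 4
    ![fun z => (L.S z p ∧ L.S z q) ∧ z < p, fun z => (L.S z p ∧ L.S z q) ∧ p < z ∧ z < q,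
      fun z => (L.S z p ∧ L.S z q) ∧ q < z, fun z => L.Q z p ∧ L.Q z q ∧ z < p] (by
      intro z hzT
      obtain ⟨hW, h₁, h₂⟩ := hz z hzT
      have hzp : z ≠ p := fun e => hW (e ▸ hp)
      have hzq : z ≠ q := fun e => hW (e ▸ hq)
      rcases h z hW h₁ h₂ with hs | hs
      · rcases hzp.lt_or_gt with hlt | hlt
        · exact ⟨0, hs, hlt⟩
        · rcases hzq.lt_or_gt with hlt' | hlt'
          · exact ⟨1, hs, hlt, hlt'⟩
          · exact ⟨2, hs, hlt'⟩
      · exact ⟨3, hs⟩) (by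
      intro i z _ z' _
      fin_cases i
      · rintro ⟨⟨a, b⟩, c⟩ ⟨⟨a', b'⟩, c'⟩ hlt
        exact L.noCross a b' hlt c' hpq
      · rintro ⟨⟨a, b⟩, c, d⟩ ⟨⟨a', b'⟩, c', d'⟩ hlt
        exact L.noCross (L.S_symm a') b c hlt d'
      · rintro ⟨⟨a, b⟩, c⟩ ⟨⟨a', b'⟩, c'⟩ hlt
        exact L.noCross (L.S_symm a) (L.S_symm b') hpq c hlt
      · rintro ⟨-, b, -⟩ ⟨a', -, hlt'⟩ hlt
        exact L.noNest b a' hlt hlt' hpq)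
  omega

/-- There is no edge between `b` and `c` if `{a, b}`, `{c, d}`, `{a, d}` are queue-edges. -/
theorem no_smiley (L : LayeredLayout V) {a b c d p q : V} (had : L.Q a d) (hab : L.Q a b)
    (hcd : L.Q c d) (ha : L.W₂ a) (hd : L.W₂ d) (hlab : a < b) (hlcd : c < d) (hbp : b < p)
    (hpq : p < q) (hqc : q < c) (hE : L.E₂ p q) : False := by
  refine L.false_of_uniform_attachments hE hpq fun z hW h₁ h₂ => Or.inl ?_
  have hp := L.mem_W₂ hE
  have hq := L.mem_W₂ (L.E₂_symm hE)
  have key : ∀ w, L.W₂ w → b < w → w < c → L.S z w ∨ L.Q z w → L.S z w := by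
    intro w hw hbw hwc e
    have hza : z ≠ a := fun e => hW (e ▸ ha)
    have hzd : z ≠ d := fun e => hW (e ▸ hd)
    have hzw : z ≠ w := fun e => hW (e ▸ hw)
    rcases hza.lt_or_gt with hlt | hlt
    · exact L.stack_of_above hab e hlt hlab hbw
    · rcases hzd.lt_or_gt with hlt' | hlt'
      · exact L.stack_of_inside had e hzw hlt hlt' (hlab.trans hbw) (hwc.trans hlcd)
      · exact L.S_symm (L.stack_of_above hcd (e.imp L.S_symm L.Q_symm) hwc hlcd hlt')
  exact ⟨key p hp hbp (hpq.trans hqc) h₁, key q hq (hbp.trans hpq) hqc h₂⟩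

/-- If `y ≺ x ≺ x'` lie inside a queue-edge `{u, v}` and `{y, x'}` is an edge, then
every other vertex attached to `x` precedes `u`. -/
theorem attachment_lt (L : LayeredLayout V) {u v x x' y y₁ : V} (huv : L.Q u v)
    (hx'v : L.Q x' v) (hu : L.W₁ u) (hv : L.W₁ v) (hx' : L.W₁ x')
    (hx : L.W₁ x) (huy : u < y) (hyx : y < x) (hxx' : x < x') (hx'v' : x' < v)
    (hE : L.E₂ y x') (hne : y₁ ≠ y) (hfresh : ¬ L.W₁ y₁) (hE' : L.E₂ y₁ x) : y₁ < u := by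
  by_contra hlt
  have hyu : u < y₁ := lt_of_le_of_ne (not_lt.1 hlt) fun e => hfresh (e ▸ hu)
  have hyv : y₁ ≠ v := fun e => hfresh (e ▸ hv)
  have hyx₁ : y₁ ≠ x := fun e => hfresh (e ▸ hx)
  have hyx' : y₁ ≠ x' := fun e => hfresh (e ▸ hx')
  have hS : L.S y x' := L.stack_of_below huv (L.E₂_edge hE) huy (hyx.trans hxx') hx'v'
  have hS₁ : L.S y₁ x := by
    rcases hyv.lt_or_gt with h | h
    · exact L.stack_of_inside huv (L.E₂_edge hE') hyx₁ hyu h (huy.trans hyx) (hxx'.trans hx'v')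
    · exact L.S_symm (L.stack_of_above hx'v ((L.E₂_edge hE').imp L.S_symm L.Q_symm) hxx' hx'v' h)
  have hy : y < y₁ := by
    rcases hne.lt_or_gt with h | h
    · exact (L.noCross hS₁ hS h hyx hxx').elim
    · exact h
  have hy' : y₁ < x' := by
    rcases hyx'.lt_or_gt with h | h
    · exact h
    · exact (L.noCross hS (L.S_symm hS₁) hyx hxx' h).elim
  have key : ∀ p q, L.E₂ p q → p < q → y < p → q < x' → False := by
    intro p q hpq hlt hyp hqx'
    refine L.false_of_uniform_attachments hpq hlt fun z hW h₁ h₂ => ?_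
    have hzu : z ≠ u := fun e => hW (e ▸ L.W₁_sub hu)
    have hzv : z ≠ v := fun e => hW (e ▸ L.W₁_sub hv)
    have hzp : z ≠ p := fun e => hW (e ▸ L.mem_W₂ hpq)
    have hzq : z ≠ q := fun e => hW (e ▸ L.mem_W₂ (L.E₂_symm hpq))
    rcases hzu.lt_or_gt with h | h
    · refine Or.inr ⟨?_, ?_, h.trans (huy.trans hyp)⟩
      · exact h₁.resolve_left fun s => L.noCross s hS (h.trans huy) hyp (hlt.trans hqx')
      · exact h₂.resolve_left fun s => L.noCross s hS (h.trans huy) (hyp.trans hlt) hqx'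
    · rcases hzv.lt_or_gt with h' | h'
      · exact Or.inl ⟨L.stack_of_inside huv h₁ hzp h h' (huy.trans hyp)
            ((hlt.trans hqx').trans hx'v'),
          L.stack_of_inside huv h₂ hzq h h' (huy.trans (hyp.trans hlt)) (hqx'.trans hx'v')⟩
      · have hs := L.stack_of_above hx'v (h₁.imp L.S_symm L.Q_symm) (hlt.trans hqx') hx'v' h'
        exact (L.noCross hS hs hyp (hlt.trans hqx') (hx'v'.trans h')).elim
  rcases hyx₁.lt_or_gt with h | h
  · exact key y₁ x hE' h hy hxx'
  · exact key x y₁ (L.E₂_symm hE') h hyx hy'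

/-- Five queue-attachments `x₁ ≺ ⋯ ≺ x₅` of a queue-edge `{u, v}`, placed inside it. -/
structure Fan (L : LayeredLayout V) (u v x₁ x₂ x₃ x₄ x₅ : V) : Prop where
  l₁ : u < x₁
  l₂ : x₁ < x₂
  l₃ : x₂ < x₃
  l₄ : x₃ < x₄
  l₅ : x₄ < x₅
  l₆ : x₅ < v
  Quv : L.Q u v
  hu : L.W₁ u
  hv : L.W₁ v
  left : ∀ x, x = x₁ ∨ x = x₂ ∨ x = x₃ ∨ x = x₄ ∨ x = x₅ → L.Q u x ∧ L.E₁ u x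
  right : ∀ x, x = x₁ ∨ x = x₂ ∨ x = x₃ ∨ x = x₄ ∨ x = x₅ → L.Q x v ∧ L.E₁ x v

variable {L : LayeredLayout V} {u v x₁ x₂ x₃ x₄ x₅ : V}

theorem or_reverse {a b c d e : Prop} (h : a ∨ b ∨ c ∨ d ∨ e) : e ∨ d ∨ c ∨ b ∨ a := by
  tauto

theorem Fan.mirror (F : L.Fan u v x₁ x₂ x₃ x₄ x₅) :
    L.mirror.Fan (OrderDual.toDual v) (OrderDual.toDual u) (OrderDual.toDual x₅)
      (OrderDual.toDual x₄) (OrderDual.toDual x₃) (OrderDual.toDual x₂) (OrderDual.toDual x₁) where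
  l₁ := F.l₆
  l₂ := F.l₅
  l₃ := F.l₄
  l₄ := F.l₃
  l₅ := F.l₂
  l₆ := F.l₁
  Quv := L.Q_symm F.Quv
  hu := F.hv
  hv := F.hu
  left x hx := by
    have h := F.right x.ofDual (or_reverse hx)
    exact ⟨L.Q_symm h.1, L.E₁_symm h.2⟩
  right x hx := by
    have h := F.left x.ofDual (or_reverse hx)
    exact ⟨L.Q_symm h.1, L.E₁_symm h.2⟩

/-- At most one common neighbour of `x` and `v` precedes `u`, for `x` inside the fan. -/
theorem left_unique (L : LayeredLayout V) {u v x₁ x y y' : V} (hQ : L.Q u x₁) (h₁ : u < x₁)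
    (h₂ : x₁ < x) (h₃ : x < v) (hy : L.E₂ y x) (hy' : L.E₂ y' v) (hlt : y < y') (hyu : y' < u) :
    False := by
  have s := L.stack_of_above hQ (L.E₂_edge hy) (hlt.trans hyu) h₁ h₂
  have s' := L.stack_of_above hQ (L.E₂_edge hy') hyu h₁ (h₂.trans h₃)
  exact L.noCross s s' hlt (hyu.trans (h₁.trans h₂)) h₃

theorem Fan.lt_of_lt_middle (F : L.Fan u v x₁ x₂ x₃ x₄ x₅) {y : V} (hy : ¬ L.W₁ y)
    (hE : L.E₂ y x₃) (hlt : y < x₃) : y < u := by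
  have ⟨l₁, l₂, l₃, l₄, l₅, l₆, _, _, _, _, _⟩ := F
  by_contra h
  have hyu : u < y := lt_of_le_of_ne (not_lt.1 h) fun e => hy (e ▸ F.hu)
  have w₂ := L.mem_W₁ (F.right x₂ (by simp)).2
  have w₃ := L.mem_W₁ (F.right x₃ (by simp)).2
  have hy₂ : y ≠ x₂ := fun e => hy (e ▸ w₂)
  rcases hy₂.lt_or_gt with h' | h'
  · obtain ⟨T, hT, hz⟩ := L.attach₁ (F.right x₂ (by simp)).2
    have := T.card_le_of_subsingleton_classes 2 ![fun z => z < u, fun z => z = y] (by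
        intro z hzT
        by_cases hzy : z = y
        · exact ⟨1, hzy⟩
        · exact ⟨0, L.attachment_lt F.Quv (F.right x₃ (by simp)).1 F.hu F.hv w₃ w₂ hyu h' l₃
            (by order) hE hzy (hz z hzT).1 (hz z hzT).2.1⟩) (by
        intro i z hzT z' hzT'
        fin_cases i
        · intro _ h₂ hlt
          exact L.left_unique (F.left x₁ (by simp)).1 l₁ l₂ (by order) (hz z hzT).2.1
            (hz z' hzT').2.2 hlt h₂
        · rintro rfl rfl hlt
          exact lt_irrefl _ hlt)
    omega
  · exact L.no_smiley F.Quv (F.left x₁ (by simp)).1 (F.right x₄ (by simp)).1 (L.W₁_sub F.hu)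
      (L.W₁_sub F.hv) l₁ (by order) (by order) hlt l₄ hE

theorem Fan.outside_of_middle (F : L.Fan u v x₁ x₂ x₃ x₄ x₅) {y : V} (hy : ¬ L.W₁ y)
    (hE : L.E₂ y x₃) : y < u ∨ v < y := by
  have hne : y ≠ x₃ := fun e => hy (e ▸ L.mem_W₁ (F.right x₃ (by simp)).2)
  rcases hne.lt_or_gt with h | h
  · exact Or.inl (F.lt_of_lt_middle hy hE h)
  · exact Or.inr (F.mirror.lt_of_lt_middle (y := OrderDual.toDual y) hy hE h)

theorem Fan.elim (F : L.Fan u v x₁ x₂ x₃ x₄ x₅) : False := by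
  have ⟨l₁, l₂, l₃, l₄, l₅, l₆, _, _, _, _, _⟩ := F
  have w₁ := L.mem_W₁ (F.right x₁ (by simp)).2
  have w₂ := L.mem_W₁ (F.right x₂ (by simp)).2
  have w₃ := L.mem_W₁ (F.right x₃ (by simp)).2
  have q₁ := (F.left x₁ (by simp)).1
  obtain ⟨a, a', haa', ha'u, hax₃, ha'x₃, hau⟩ :
      ∃ a a', a < a' ∧ a' < u ∧ L.E₂ a x₃ ∧ L.E₂ a' x₃ ∧ L.E₂ a u := by
    by_contra hcon
    obtain ⟨T, hT, hz⟩ := L.attach₁ (F.left x₃ (by simp)).2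
    have := T.card_le_of_subsingleton_classes 2 ![fun z => z < u, fun z => v < z] (by
        intro z hzT
        rcases F.outside_of_middle (hz z hzT).1 (hz z hzT).2.2 with h | h
        · exact ⟨0, h⟩
        · exact ⟨1, h⟩) (by
        intro i z hzT z' hzT'
        fin_cases i
        · intro _ h₂ hlt
          exact hcon ⟨z, z', hlt, h₂, (hz z hzT).2.2, (hz z' hzT').2.2, (hz z hzT).2.1⟩
        · intro h₁ _ hlt
          exact L.mirror.left_unique (u := OrderDual.toDual v) (v := OrderDual.toDual u)
            (x₁ := OrderDual.toDual x₅) (x := OrderDual.toDual x₃) (y := OrderDual.toDual z')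
            (y' := OrderDual.toDual z) (L.Q_symm (F.right x₅ (by simp)).1) l₆
            (show x₃ < x₅ by order) (show u < x₃ by order) (hz z' hzT').2.2 (hz z hzT).2.1 hlt h₁)
    omega
  have sa : L.S a x₃ := L.stack_of_above q₁ (L.E₂_edge hax₃) (by order) l₁ (by order)
  have sa' : L.S a' x₃ := L.stack_of_above q₁ (L.E₂_edge ha'x₃) ha'u l₁ (by order)
  have qa : L.Q a u := (L.E₂_edge hau).resolve_left fun s =>
    L.noCross s sa' haa' ha'u (by order)
  obtain ⟨y, huy, hyx₁, hyx₂⟩ : ∃ y, u < y ∧ y < x₁ ∧ L.E₂ y x₂ := by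
    obtain ⟨T, hT, hz⟩ := L.attach₁ (F.right x₂ (by simp)).2
    obtain ⟨y, hyT, hyu⟩ : ∃ y ∈ T, ¬ y < u := by
      by_contra! hcon
      have := T.card_le_of_subsingleton_classes 1 ![fun z => z < u]
        (fun z hzT => ⟨0, hcon z hzT⟩) (by
          intro i z hzT z' hzT'
          fin_cases i
          intro _ h₂ hlt
          exact L.left_unique q₁ l₁ l₂ (by order) (hz z hzT).2.1 (hz z' hzT').2.2 hlt h₂)
      omega
    obtain ⟨hW, hE, -⟩ := hz y hyT
    have ne : ∀ {w}, L.W₁ w → y ≠ w := fun hw e => hW (e ▸ hw)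
    have huy : u < y := lt_of_le_of_ne (not_lt.1 hyu) (ne F.hu).symm
    have hsm : ∀ p q, L.E₂ p q → x₁ < p → p < q → q < x₄ → False := fun p q hpq h₁ h₂ h₃ =>
      L.no_smiley F.Quv q₁ (F.right x₄ (by simp)).1 (L.W₁_sub F.hu) (L.W₁_sub F.hv) l₁
        (by order) h₁ h₂ h₃ hpq
    refine ⟨y, huy, ?_, hE⟩
    rcases (ne w₁).lt_or_gt with h | h
    · exact h
    exfalso
    rcases (ne w₂).lt_or_gt with h₂ | h₂
    · exact hsm y x₂ hE h h₂ (by order)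
    rcases (ne w₃).lt_or_gt with h₃ | h₃
    · exact hsm x₂ y (L.E₂_symm hE) l₂ h₂ (by order)
    have s : L.S x₂ y := by
      have e := (L.E₂_edge hE).imp L.S_symm L.Q_symm
      rcases (ne F.hv).lt_or_gt with h₄ | h₄
      · exact L.stack_of_below F.Quv e (by order) h₂ h₄
      · exact L.stack_of_above (F.right x₃ (by simp)).1 e l₃ (by order) h₄
    exact L.noCross sa s (by order) l₃ h₃
  obtain ⟨T, hT, hz⟩ := L.attach₁ (F.right x₁ (by simp)).2
  obtain ⟨b, hbT, hby, hba⟩ : ∃ b ∈ T, b ≠ y ∧ b ≠ a := by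
    by_contra! hcon
    have := T.card_le_of_subsingleton_classes 2 ![fun z => z = y, fun z => z = a] (by
        intro z hzT
        by_cases hzy : z = y
        · exact ⟨0, hzy⟩
        · exact ⟨1, hcon z hzT hzy⟩) (by
        intro i z _ z' _
        fin_cases i <;>
        · rintro rfl rfl hlt
          exact lt_irrefl _ hlt)
    omega
  obtain ⟨hW, hE₁, hEv⟩ := hz b hbT
  have hbu : b < u := L.attachment_lt F.Quv (F.right x₂ (by simp)).1 F.hu F.hv w₂ w₁ huy hyx₁ l₂
    (by order) hyx₂ hby hW hE₁
  rcases hba.lt_or_gt with h | h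
  · rcases L.E₂_edge hE₁ with s | q
    · exact L.noCross s sa h (by order) (by order)
    · exact L.noNest q qa h (by order) l₁
  · have s := L.stack_of_above q₁ (L.E₂_edge hEv) hbu l₁ (by order)
    exact L.noCross sa s h (by order) (by order)

theorem card_queue_attachments_le (L : LayeredLayout V) {u v : V} (huv : u < v) (hQ : L.Q u v)
    (hu : L.W₁ u) (hv : L.W₁ v) (T : Finset V)
    (hT : ∀ x ∈ T, x ≠ u ∧ x ≠ v ∧ L.E₁ x u ∧ L.E₁ x v ∧ L.Q x u ∧ L.Q x v) : T.card ≤ 6 := by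
  have hl : (T.filter (· < u)).card ≤ 1 := by
    refine Finset.card_le_of_subsingleton_classes _ 1 ![fun z => z < u]
      (fun z hz => ⟨0, (Finset.mem_filter.1 hz).2⟩) fun i z hz z' hz' _ _ hlt => ?_
    obtain ⟨hz, -⟩ := Finset.mem_filter.1 hz
    obtain ⟨hz', h'⟩ := Finset.mem_filter.1 hz'
    exact L.noNest (hT z hz).2.2.2.2.2 (hT z' hz').2.2.2.2.1 hlt h' huv
  have hr : (T.filter (v < ·)).card ≤ 1 := by
    refine Finset.card_le_of_subsingleton_classes _ 1 ![fun z => v < z]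
      (fun z hz => ⟨0, (Finset.mem_filter.1 hz).2⟩) fun i z hz z' hz' _ _ hlt => ?_
    obtain ⟨hz, h⟩ := Finset.mem_filter.1 hz
    obtain ⟨hz', -⟩ := Finset.mem_filter.1 hz'
    exact L.noNest (L.Q_symm (hT z' hz').2.2.2.2.1) (L.Q_symm (hT z hz).2.2.2.2.2) huv h hlt
  have hm : (T.filter fun x => u < x ∧ x < v).card ≤ 4 := by
    by_contra! hcard
    obtain ⟨M, hM, hM5⟩ := Finset.exists_subset_card_eq (Nat.succ_le_of_lt hcard)
    let x := M.orderEmbOfFin hM5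
    have hx : ∀ i, x i ∈ T ∧ u < x i ∧ x i < v := fun i =>
      Finset.mem_filter.1 (hM (M.orderEmbOfFin_mem hM5 i))
    have hxlt : ∀ i j, i < j → x i < x j := fun i j h => x.strictMono h
    have F : L.Fan u v (x 0) (x 1) (x 2) (x 3) (x 4) :=
      { l₁ := (hx 0).2.1
        l₂ := hxlt _ _ (by decide)
        l₃ := hxlt _ _ (by decide)
        l₄ := hxlt _ _ (by decide)
        l₅ := hxlt _ _ (by decide)
        l₆ := (hx 4).2.2
        Quv := hQ
        hu := hu
        hv := hv
        left := by
          intro y hy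
          have h := hT y (by rcases hy with rfl | rfl | rfl | rfl | rfl <;> exact (hx _).1)
          exact ⟨L.Q_symm h.2.2.2.2.1, L.E₁_symm h.2.2.1⟩
        right := by
          intro y hy
          have h := hT y (by rcases hy with rfl | rfl | rfl | rfl | rfl <;> exact (hx _).1)
          exact ⟨h.2.2.2.2.2, h.2.2.2.1⟩ }
    exact F.elim
  have hsub : T ⊆ T.filter (· < u) ∪ (T.filter (fun x => u < x ∧ x < v) ∪ T.filter (v < ·)) := by
    intro x hx
    obtain ⟨h₁, h₂, -⟩ := hT x hx
    simp only [Finset.mem_union, Finset.mem_filter, hx, true_and]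
    rcases h₁.lt_or_gt with h | h
    · exact Or.inl h
    · exact Or.inr (h₂.lt_or_gt.imp (fun h' => ⟨h, h'⟩) id)
  have c₁ := Finset.card_le_card hsub
  have c₂ := Finset.card_union_le (T.filter (· < u))
    (T.filter (fun x => u < x ∧ x < v) ∪ T.filter (v < ·))
  have c₃ := Finset.card_union_le (T.filter (fun x => u < x ∧ x < v)) (T.filter (v < ·))
  omega

end LayeredLayout

theorem Gedges_index_le {ℓ : ℕ} : ∀ (n : ℕ) (p : PV ℓ × PV ℓ), p ∈ Gedges ℓ n →
    ∀ (m : ℕ) (a b : PV ℓ) (i : Fin ℓ), p.1 = PV.att m a b i ∨ p.2 = PV.att m a b i → m ≤ n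
  | 0, _, hp => hp.elim
  | 1, _, hp => by
    obtain rfl : _ = _ := hp
    simp
  | n + 2, p, hp => by
    intro m a b i h
    rcases hp with hp | ⟨u, v, j, huv, rfl | rfl⟩
    · exact (Gedges_index_le (n + 1) p hp m a b i h).trans (Nat.le_succ _)
    · rcases h with h | h
      · cases h
        exact le_rfl
      · exact (Gedges_index_le (n + 1) _ huv m a b i (Or.inl h)).trans (Nat.le_succ _)
    · rcases h with h | h
      · cases h
        exact le_rfl
      · exact (Gedges_index_le (n + 1) _ huv m a b i (Or.inr h)).trans (Nat.le_succ _)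

theorem Gkl_adj_iff {ℓ n : ℕ} {a b : PV ℓ} :
    (Gkl n ℓ).Adj a b ↔ ((a, b) ∈ Gedges ℓ n ∨ (b, a) ∈ Gedges ℓ n) ∧ a ≠ b := by
  simp only [Gkl, SimpleGraph.fromEdgeSet_adj, Set.mem_image, Prod.exists, Sym2.eq_iff]
  constructor
  · rintro ⟨⟨c, d, h, ⟨rfl, rfl⟩ | ⟨rfl, rfl⟩⟩, hne⟩
    · exact ⟨Or.inl h, hne⟩
    · exact ⟨Or.inr h, hne⟩
  · rintro ⟨h | h, hne⟩
    · exact ⟨⟨a, b, h, by simp⟩, hne⟩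
    · exact ⟨⟨b, a, h, by simp⟩, hne⟩

theorem Gkl_mono {ℓ m n : ℕ} (h : m ≤ n) : Gkl m ℓ ≤ Gkl n ℓ := by
  have hstep : ∀ n, Gedges ℓ n ⊆ Gedges ℓ (n + 1) := by
    intro n
    cases n with
    | zero => exact Set.empty_subset _
    | succ n => exact Set.subset_union_left
  have hsub : Gedges ℓ m ⊆ Gedges ℓ n := monotone_nat_of_le_succ hstep h
  intro a b hab
  rw [Gkl_adj_iff] at hab ⊢
  exact ⟨hab.1.imp (@hsub _) (@hsub _), hab.2⟩

theorem Gbar_le_Gkl (n ℓ : ℕ) : Gbar n ℓ ≤ Gkl n ℓ :=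
  SimpleGraph.fromEdgeSet_mono (Set.image_mono Set.sdiff_subset)

/-- Every edge of `G(n,ℓ)` has `ℓ` new attachments in `G(n+1,ℓ)`. -/
theorem Gkl_attachments {ℓ n : ℕ} {p q : PV ℓ} (h : (Gkl n ℓ).Adj p q) :
    ∃ T : Finset (PV ℓ), T.card = ℓ ∧ ∀ y ∈ T, (¬ ∃ w, (Gkl n ℓ).Adj y w) ∧
      (Gkl (n + 1) ℓ).Adj y p ∧ (Gkl (n + 1) ℓ).Adj y q := by
  wlog hpq : (p, q) ∈ Gedges ℓ n generalizing p q
  · obtain ⟨T, hT, h'⟩ := this h.symm ((Gkl_adj_iff.1 h).1.resolve_left hpq)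
    exact ⟨T, hT, fun y hy => ⟨(h' y hy).1, (h' y hy).2.2, (h' y hy).2.1⟩⟩
  obtain ⟨n, rfl⟩ : ∃ m, n = m + 1 := by
    cases n with
    | zero => exact hpq.elim
    | succ m => exact ⟨m, rfl⟩
  have hinj : Function.Injective fun i : Fin ℓ => PV.att (n + 2) p q i := by
    intro i j hij
    cases hij
    rfl
  refine ⟨Finset.univ.map ⟨_, hinj⟩, by simp, fun y hy => ?_⟩
  obtain ⟨i, -, rfl⟩ := Finset.mem_map.1 hy
  have hne : ∀ w : PV ℓ, (∀ m a b i, w = PV.att m a b i → m ≤ n + 1) →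
      PV.att (n + 2) p q i ≠ w := fun w hw e => by
    have := hw _ _ _ _ e.symm
    omega
  refine ⟨?_, ?_, ?_⟩
  · rintro ⟨w, hw⟩
    rcases (Gkl_adj_iff.1 hw).1 with e | e
    · have := Gedges_index_le _ _ e _ _ _ _ (Or.inl rfl)
      omega
    · have := Gedges_index_le _ _ e _ _ _ _ (Or.inr rfl)
      omega
  · exact Gkl_adj_iff.2 ⟨Or.inl (Or.inr ⟨p, q, i, hpq, Or.inl rfl⟩),
      hne p fun m a b j e => Gedges_index_le _ _ hpq m a b j (Or.inl e)⟩
  · exact Gkl_adj_iff.2 ⟨Or.inl (Or.inr ⟨p, q, i, hpq, Or.inr rfl⟩),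
      hne q fun m a b j e => Gedges_index_le _ _ hpq m a b j (Or.inr e)⟩

/-- The last three layers of a mixed layout of `G(n+2,ℓ)`. -/
def MixedLayout.toLayered {ℓ n : ℕ} (hl : 6 < ℓ) [LinearOrder (PV ℓ)]
    (L : MixedLayout (Gkl (n + 2) ℓ)) (hlt : ∀ a b, L.lt a b ↔ a < b) :
    LayeredLayout (PV ℓ) where
  S a b := (Gkl (n + 2) ℓ).Adj a b ∧ L.isStack s(a, b)
  Q a b := (Gkl (n + 2) ℓ).Adj a b ∧ ¬ L.isStack s(a, b)
  E₁ := (Gkl n ℓ).Adj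
  E₂ := (Gkl (n + 1) ℓ).Adj
  W₁ a := ∃ w, (Gkl n ℓ).Adj a w
  W₂ a := ∃ w, (Gkl (n + 1) ℓ).Adj a w
  S_symm h := ⟨h.1.symm, Sym2.eq_swap ▸ h.2⟩
  Q_symm h := ⟨h.1.symm, Sym2.eq_swap ▸ h.2⟩
  E₁_symm h := h.symm
  E₂_symm h := h.symm
  noCross h h' h₁ h₂ h₃ := L.noCross _ _ _ _ h.1 h'.1 h.2 h'.2
    ⟨(hlt _ _).2 h₁, (hlt _ _).2 h₂, (hlt _ _).2 h₃⟩
  noNest h h' h₁ h₂ h₃ := L.noNest _ _ _ _ h.1 h'.1 h.2 h'.2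
    ⟨(hlt _ _).2 h₁, (hlt _ _).2 h₂, (hlt _ _).2 h₃⟩
  mem_W₁ h := ⟨_, h⟩
  mem_W₂ h := ⟨_, h⟩
  W₁_sub := fun ⟨w, h⟩ => ⟨w, Gkl_mono (Nat.le_succ n) h⟩
  E₂_edge h :=
    have h' := Gkl_mono (Nat.le_succ (n + 1)) h
    (Classical.em _).imp (⟨h', ·⟩) (⟨h', ·⟩)
  attach₁ h := by
    obtain ⟨T, hT, h'⟩ := Gkl_attachments h
    obtain ⟨M, hM, hM7⟩ := Finset.exists_subset_card_eq (s := T) (n := 7) (by omega)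
    exact ⟨M, hM7, fun y hy => h' y (hM hy)⟩
  attach₂ h := by
    obtain ⟨T, hT, h'⟩ := Gkl_attachments h
    obtain ⟨M, hM, hM7⟩ := Finset.exists_subset_card_eq (s := T) (n := 7) (by omega)
    refine ⟨M, hM7, fun y hy => ?_⟩
    obtain ⟨h₁, h₂, h₃⟩ := h' y (hM hy)
    exact ⟨h₁, (Classical.em _).imp (⟨h₂, ·⟩) (⟨h₂, ·⟩), (Classical.em _).imp (⟨h₃, ·⟩) (⟨h₃, ·⟩)⟩

/-- Every queue-edge of `G(k-3,ℓ)` has at most six queue-attachments among the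
vertices of `Ḡ(k-2,ℓ)` attached to it. -/
theorem at_most_six_queue_attachments (k ℓ : ℕ) (hk : 4 < k) (hl : 6 < ℓ)
    (L : MixedLayout (Gkl k ℓ)) (u v : PV ℓ)
    (huv : QEdgeIn L (Gkl (k - 3) ℓ) u v) :
    {x : PV ℓ | AttachedAt ℓ (k - 2) x u v ∧ QueueAtt L x u v}.ncard ≤ 6 := by
  obtain ⟨n, rfl⟩ : ∃ n, k = n + 2 := ⟨k - 2, by omega⟩
  wlog hlt : L.lt u v generalizing u v
  · have hadj := Gkl_mono (Nat.sub_le (n + 2) 3) huv.1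
    have huv' : QEdgeIn L (Gkl (n + 2 - 3) ℓ) v u := ⟨huv.1.symm, Sym2.eq_swap ▸ huv.2⟩
    have htri := L.isSTO.toTrichotomous.trichotomous u v hlt
    have hvu : L.lt v u := by
      by_contra h
      exact hadj.ne (htri h)
    refine le_trans (le_of_eq (congrArg Set.ncard ?_)) (this v u huv' hvu)
    ext x
    simp only [AttachedAt, QueueAtt, Set.mem_ofPred_eq, and_comm]
  have hSTO := L.isSTO
  classical
  let _ : LinearOrder (PV ℓ) := linearOrderOfSTO L.lt
  let M := L.toLayered hl fun a b => Iff.rfl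
  have hE : (Gkl n ℓ).Adj u v := Gkl_mono (by omega) huv.1
  by_contra! hcard
  have hfin := Set.finite_of_ncard_pos (lt_of_le_of_lt (Nat.zero_le 6) hcard)
  rw [Set.ncard_eq_toFinset_card _ hfin] at hcard
  refine hcard.not_ge (M.card_queue_attachments_le hlt
    ⟨Gkl_mono (Nat.sub_le (n + 2) 3) huv.1, huv.2⟩ ⟨v, hE⟩ ⟨u, hE.symm⟩ _ fun x hx => ?_)
  obtain ⟨⟨h₁, h₂⟩, h₃, h₄⟩ := hfin.mem_toFinset.1 hx
  exact ⟨h₁.ne, h₂.ne, Gbar_le_Gkl _ _ h₁, Gbar_le_Gkl _ _ h₂, h₃, h₄⟩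
end

section
/- Let L be a mixed 1-stack 1-queue layout of G(k,ℓ) with k > 1 and ℓ > 4. Then the vertices and edges of the subgraph G(k-1,ℓ) do not form Pattern P.1a in L: there are no seven vertices p1,…,p7 of G(k-1,ℓ), ordered p1 ≺ p2 ≺ … ≺ p7 or p7 ≺ p6 ≺ … ≺ p1, such that {p2,p3}, {p2,p6}, {p4,p5} are stack-edges of G(k-1,ℓ) and {p1,p7} is a queue-edge of G(k-1,ℓ). -/
namespace MixedLayout

variable {V : Type} {G : SimpleGraph V}

/-- The layout obtained by reversing the vertex order. -/
def reverse (L : MixedLayout G) : MixedLayout G where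
  lt a b := L.lt b a
  isSTO :=
    have := L.isSTO
    inferInstanceAs (IsStrictTotalOrder V (Function.swap L.lt))
  isStack := L.isStack
  noCross a b c d hab hcd sab scd h :=
    L.noCross d c b a hcd.symm hab.symm (by rwa [Sym2.eq_swap]) (by rwa [Sym2.eq_swap])
      ⟨h.2.2, h.2.1, h.1⟩
  noNest a b c d hab hcd sab scd h :=
    L.noNest b a d c hab.symm hcd.symm (by rwa [Sym2.eq_swap]) (by rwa [Sym2.eq_swap])
      ⟨h.2.2, h.2.1, h.1⟩

variable (L : MixedLayout G)

theorem lt_trans {a b c : V} (hab : L.lt a b) (hbc : L.lt b c) : L.lt a c :=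
  have := L.isSTO
  _root_.trans hab hbc

theorem lt_of_not_lt_of_ne {a b : V} (h : ¬L.lt a b) (hne : a ≠ b) : L.lt b a := by
  have := L.isSTO
  rcases trichotomous_of L.lt a b with h' | h' | h'
  exacts [absurd h' h, absurd h' hne, h']

/-- An edge strictly below a queue-edge is a stack-edge. -/
theorem isStack_of_below_queue {a b c d : V} (hab : G.Adj a b) (hq : ¬L.isStack s(a, b))
    (hcd : G.Adj c d) (hac : L.lt a c) (hcb : L.lt c b) (had : L.lt a d) (hdb : L.lt d b) :
    L.isStack s(c, d) := by
  by_contra hs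
  by_cases h : L.lt c d
  · exact L.noNest a b c d hab hcd hq hs ⟨hac, h, hdb⟩
  · exact L.noNest a b d c hab hcd.symm hq (by rwa [Sym2.eq_swap])
      ⟨had, L.lt_of_not_lt_of_ne h hcd.ne, hcb⟩

/-- A stack-edge with one end strictly below another stack-edge has no end strictly outside
of it. -/
theorem between_of_isStack {a b c d : V} (hab : G.Adj a b) (hs : L.isStack s(a, b))
    (hcd : G.Adj c d) (hs' : L.isStack s(c, d)) (hac : L.lt a c) (hcb : L.lt c b) :
    ¬L.lt d a ∧ ¬L.lt b d := by
  refine ⟨fun h => ?_, fun h => L.noCross a b c d hab hcd hs hs' ⟨hac, hcb, h⟩⟩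
  exact L.noCross d c a b hcd.symm hab (by rwa [Sym2.eq_swap]) hs ⟨h, hac, hcb⟩

/-- An edge `{u,v}` covered by a stack-edge `{b,c}`, itself covered by a queue-edge `{a,d}`, has
at most four common neighbours other than `a`, `b`, `c`, `d`. -/
theorem card_common_neighbors_le_four {n : ℕ} {a b u v c d : V}
    (hab : L.lt a b) (hbu : L.lt b u) (huv : L.lt u v) (hvc : L.lt v c) (hcd : L.lt c d)
    (hbc : G.Adj b c) (sbc : L.isStack s(b, c)) (had : G.Adj a d) (qad : ¬L.isStack s(a, d))
    (x : Fin n → V) (hx : Function.Injective x) (hxu : ∀ i, G.Adj u (x i))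
    (hxv : ∀ i, G.Adj v (x i)) (hxa : ∀ i, x i ≠ a) (hxd : ∀ i, x i ≠ d) : n ≤ 4 := by
  classical
  have hau := L.lt_trans hab hbu
  have hbv := L.lt_trans hbu huv
  have hav := L.lt_trans hab hbv
  have huc := L.lt_trans huv hvc
  have hvd := L.lt_trans hvc hcd
  have hud := L.lt_trans huv hvd
  have outer_u : ∀ i, L.lt (x i) a ∨ L.lt d (x i) → ¬L.isStack s(u, x i) := fun i h hs =>
    have h' := L.between_of_isStack hbc sbc (hxu i) hs hbu huc
    h.elim (fun h => h'.1 (L.lt_trans h hab)) (fun h => h'.2 (L.lt_trans hcd h))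
  have outer_v : ∀ i, L.lt (x i) a ∨ L.lt d (x i) → ¬L.isStack s(v, x i) := fun i h hs =>
    have h' := L.between_of_isStack hbc sbc (hxv i) hs hbv hvc
    h.elim (fun h => h'.1 (L.lt_trans h hab)) (fun h => h'.2 (L.lt_trans hcd h))
  have inner : ∀ i, ¬L.lt (x i) a → ¬L.lt d (x i) →
      L.isStack s(u, x i) ∧ L.isStack s(v, x i) := fun i h₁ h₂ =>
    have h₁' := L.lt_of_not_lt_of_ne h₁ (hxa i)
    have h₂' := L.lt_of_not_lt_of_ne h₂ (hxd i).symm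
    ⟨L.isStack_of_below_queue had qad (hxu i) hau hud h₁' h₂',
      L.isStack_of_below_queue had qad (hxv i) hav hvd h₁' h₂'⟩
  let f : Fin n → Fin 4 := fun i =>
    if L.lt (x i) a then 0 else if L.lt d (x i) then 1
    else if L.lt u (x i) ∧ L.lt (x i) v then 2 else 3
  have key : ∀ i j, L.lt (x i) (x j) → f i ≠ f j := by
    intro i j hij hf
    have su := fun k => Sym2.eq_swap (a := u) (b := x k)
    have sv := fun k => Sym2.eq_swap (a := v) (b := x k)
    by_cases hi : L.lt (x i) a
    · have hj : L.lt (x j) a := by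
        by_contra hj
        simp only [f, hi, hj, if_true, if_false] at hf
        split_ifs at hf <;> simp_all
      exact L.noNest (x i) v (x j) u (hxv i).symm (hxu j).symm (sv i ▸ outer_v i (.inl hi))
        (su j ▸ outer_u j (.inl hj)) ⟨hij, L.lt_trans hj hau, huv⟩
    by_cases hj : L.lt (x j) a
    · exact hi (L.lt_trans hij hj)
    by_cases hi' : L.lt d (x i)
    · exact L.noNest u (x j) v (x i) (hxu j) (hxv i)
        (outer_u j (.inr (L.lt_trans hi' hij))) (outer_v i (.inr hi'))
        ⟨huv, L.lt_trans hvd hi', hij⟩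
    by_cases hj' : L.lt d (x j)
    · simp only [f, hi, hj, hi', hj', if_true, if_false] at hf
      split_ifs at hf <;> simp_all
    obtain ⟨iu, iv⟩ := inner i hi hi'
    obtain ⟨ju, jv⟩ := inner j hj hj'
    by_cases hi₂ : L.lt u (x i) ∧ L.lt (x i) v
    · have hj₂ : L.lt u (x j) ∧ L.lt (x j) v := by
        by_contra hj₂
        simp only [f, hi, hj, hi', hj', if_false, if_pos hi₂, if_neg hj₂] at hf
        simp at hf
      exact L.noCross u (x j) (x i) v (hxu j) (hxv i).symm ju (sv i ▸ iv)
        ⟨hi₂.1, hij, hj₂.2⟩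
    have hj₂ : ¬(L.lt u (x j) ∧ L.lt (x j) v) := by
      intro hj₂
      simp only [f, hi, hj, hi', hj', if_false, if_pos hj₂, if_neg hi₂] at hf
      simp at hf
    by_cases hui : L.lt u (x i)
    · have hvi := L.lt_of_not_lt_of_ne (fun h => hi₂ ⟨hui, h⟩) (hxv i).ne'
      exact L.noCross u (x i) v (x j) (hxu i) (hxv j) iu jv ⟨huv, hvi, hij⟩
    have hiu := L.lt_of_not_lt_of_ne hui (hxu i).ne
    by_cases huj : L.lt u (x j)
    · have hvj := L.lt_of_not_lt_of_ne (fun h => hj₂ ⟨huj, h⟩) (hxv j).ne'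
      exact L.noCross (x i) v u (x j) (hxv i).symm (hxu j) (sv i ▸ iv) ju ⟨hiu, huv, hvj⟩
    have hju := L.lt_of_not_lt_of_ne huj (hxu j).ne
    exact L.noCross (x i) u (x j) v (hxu i).symm (hxv j).symm (su i ▸ iu) (sv j ▸ jv)
      ⟨hij, hju, huv⟩
  have hf : Function.Injective f := by
    intro i j h
    by_contra hne
    by_cases hij : L.lt (x i) (x j)
    · exact key i j hij h
    · exact key j i (L.lt_of_not_lt_of_ne hij (hx.ne hne)) h.symm
  simpa using Fintype.card_le_of_injective f hf

end MixedLayout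

theorem ne_att_of_mem_Gedges {ℓ n : ℕ} {p : PV ℓ × PV ℓ} (hp : p ∈ Gedges ℓ n) {m : ℕ}
    (hm : n < m) (u v : PV ℓ) (i : Fin ℓ) : p.1 ≠ .att m u v i ∧ p.2 ≠ .att m u v i := by
  induction n using Nat.strong_induction_on generalizing p with
  | _ n ih =>
    match n, hp with
    | 1, hp =>
      obtain rfl : p = (PV.A, PV.B) := hp
      simp
    | n + 2, .inl hp => exact ih (n + 1) (by omega) hp (by omega)
    | n + 2, .inr ⟨u', v', j, h, hp⟩ =>
      have := ih (n + 1) (by omega) h (by omega)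
      rcases hp with rfl | rfl
      · exact ⟨by simp; omega, this.1⟩
      · exact ⟨by simp; omega, this.2⟩

theorem Gkl_adj {k ℓ : ℕ} {a b : PV ℓ} :
    (Gkl k ℓ).Adj a b ↔ ((a, b) ∈ Gedges ℓ k ∨ (b, a) ∈ Gedges ℓ k) ∧ a ≠ b := by
  simp only [Gkl, SimpleGraph.fromEdgeSet_adj, Set.mem_image, Prod.exists, Sym2.eq_iff]
  grind

theorem ne_att_of_Gkl_adj {n m ℓ : ℕ} {a b : PV ℓ} (h : (Gkl n ℓ).Adj a b) (hm : n < m)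
    (u v : PV ℓ) (i : Fin ℓ) : a ≠ .att m u v i ∧ b ≠ .att m u v i := by
  rcases (Gkl_adj.1 h).1 with h | h
  · exact ne_att_of_mem_Gedges h hm u v i
  · exact (ne_att_of_mem_Gedges h hm u v i).symm

theorem Gkl_le_succ (n ℓ : ℕ) : Gkl (n + 1) ℓ ≤ Gkl (n + 2) ℓ := by
  intro a b h
  rw [Gkl_adj] at h ⊢
  exact ⟨h.1.imp .inl .inl, h.2⟩

/-- Every edge of `G(n+1,ℓ)` has `ℓ` common neighbours in `G(n+2,ℓ)` outside of `G(n+1,ℓ)`. -/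
theorem exists_attached {n ℓ : ℕ} {a b : PV ℓ} (h : (Gkl (n + 1) ℓ).Adj a b) :
    ∃ x : Fin ℓ → PV ℓ, Function.Injective x ∧
      (∀ i, (Gkl (n + 2) ℓ).Adj a (x i)) ∧ (∀ i, (Gkl (n + 2) ℓ).Adj b (x i)) ∧
      ∀ i c d, (Gkl (n + 1) ℓ).Adj c d → x i ≠ c ∧ x i ≠ d := by
  wlog hab : (a, b) ∈ Gedges ℓ (n + 1) generalizing a b
  · obtain ⟨x, hx, hb, ha, hn⟩ := this h.symm ((Gkl_adj.1 h).1.resolve_left hab)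
    exact ⟨x, hx, ha, hb, hn⟩
  have fresh {c d : PV ℓ} (h : (Gkl (n + 1) ℓ).Adj c d) (i : Fin ℓ) :=
    ne_att_of_Gkl_adj h (Nat.lt_succ_self (n + 1)) a b i
  refine ⟨PV.att (n + 2) a b, fun i j h => by simpa using h, fun i => ?_, fun i => ?_,
    fun i c d hcd => ⟨(fresh hcd i).1.symm, (fresh hcd i).2.symm⟩⟩
  · exact Gkl_adj.2 ⟨.inr (.inr ⟨a, b, i, hab, .inl rfl⟩), (fresh h i).1⟩
  · exact Gkl_adj.2 ⟨.inr (.inr ⟨a, b, i, hab, .inr rfl⟩), (fresh h i).2⟩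

/-- Pattern P.1a is forbidden: no seven vertices `p1 ≺ … ≺ p7` (or `p7 ≺ … ≺ p1`)
of `G(k-1,ℓ)` with stack-edges `{p2,p3}`, `{p2,p6}`, `{p4,p5}` and queue-edge
`{p1,p7}` of `G(k-1,ℓ)`. -/
theorem no_pattern_P1a (k ℓ : ℕ) (hk : 1 < k) (hl : 4 < ℓ)
    (L : MixedLayout (Gkl k ℓ)) :
    ¬∃ p1 p2 p3 p4 p5 p6 p7 : PV ℓ,
      ((L.lt p1 p2 ∧ L.lt p2 p3 ∧ L.lt p3 p4 ∧ L.lt p4 p5 ∧ L.lt p5 p6 ∧ L.lt p6 p7) ∨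
        (L.lt p7 p6 ∧ L.lt p6 p5 ∧ L.lt p5 p4 ∧ L.lt p4 p3 ∧ L.lt p3 p2 ∧ L.lt p2 p1)) ∧
      SEdgeIn L (Gkl (k - 1) ℓ) p2 p3 ∧ SEdgeIn L (Gkl (k - 1) ℓ) p2 p6 ∧
      SEdgeIn L (Gkl (k - 1) ℓ) p4 p5 ∧ QEdgeIn L (Gkl (k - 1) ℓ) p1 p7 := by
  obtain ⟨n, rfl⟩ : ∃ n, k = n + 2 := ⟨k - 2, by omega⟩
  rintro ⟨p1, p2, p3, p4, p5, p6, p7, hlt, -, h26, h45, h17⟩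
  obtain ⟨x, hx, h4, h5, hn⟩ := exists_attached h45.1
  have h26' := Gkl_le_succ n ℓ h26.1
  have h17' := Gkl_le_succ n ℓ h17.1
  have hx1 i := (hn i _ _ h17.1).1
  have hx7 i := (hn i _ _ h17.1).2
  rcases hlt with ⟨h₁, h₂, h₃, h₄, h₅, h₆⟩ | ⟨h₆, h₅, h₄, h₃, h₂, h₁⟩
  · exact absurd (L.card_common_neighbors_le_four h₁ (L.lt_trans h₂ h₃) h₄ h₅ h₆
      h26' h26.2 h17' h17.2 x hx h4 h5 hx1 hx7) (by omega)
  · exact absurd (L.reverse.card_common_neighbors_le_four h₁ (L.reverse.lt_trans h₂ h₃) h₄ h₅ h₆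
      h26' h26.2 h17' h17.2 x hx h4 h5 hx1 hx7) (by omega)
end
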